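/- Suppose m_1, …, m_n are nonnegative integers. There exist constants C > 0 and R₀ > 1 such that for all r ≥ R₀, ∏_{k=1}^∞ p_k(r) ≥ exp( −(n/4) r^{4/n} − (n/2) r^{2/n} log(r^{2/n}) − Σ_{a=1}^n ( C(m_a) − m_a + log Γ(m_a + 1) + log 4 ) r^{2/n} − C log r ). (Lower bound for the hole probability of the generalised induced infinite complex Ginibre ensemble.) -/

import Mathlib

open MeasureTheory Real

/-- The second Bernoulli periodic function `P₂(x) = (x-⌊x⌋)² - (x-⌊x⌋) + 1/6`. -/
noncomputable def bernoulliPeriodic₂ (x : ℝ) : ℝ :=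
  Int.fract x ^ 2 - Int.fract x + 1 / 6

/-- The constant `C(m)` appearing in the lower bound for the hole probability. -/
noncomputable def holeConstC (m : ℝ) : ℝ :=
  m + 1 - 1 / (12 * (m + 1)) - (1 / 2 + m) * Real.log (1 + m) +
    (1 / 2) * ∫ x in Set.Ioi (1 : ℝ), bernoulliPeriodic₂ x / (m + x) ^ 2

/-- The probability that a Gamma variable of shape `j + 1` and rate `1` exceeds `R`. -/
noncomputable def gammaTail (j : ℕ) (R : ℝ) : ℝ :=
  (∫ x in Set.Ioi R, x ^ j * exp (-x)) / (j.factorial : ℝ)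

lemma integrableOn_pow_mul_exp_neg (j : ℕ) :
    IntegrableOn (fun x : ℝ => x ^ j * exp (-x)) (Set.Ioi 0) := by
  have h := Real.GammaIntegral_convergent (s := (j : ℝ) + 1) (by positivity)
  refine h.congr_fun (fun x _ => ?_) measurableSet_Ioi
  simp only [add_sub_cancel_right, Real.rpow_natCast]
  ring

lemma integral_pow_mul_exp_neg (j : ℕ) :
    ∫ x in Set.Ioi (0 : ℝ), x ^ j * exp (-x) = (j.factorial : ℝ) := by
  rw [← Real.Gamma_nat_eq_factorial, Real.Gamma_eq_integral (by positivity)]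
  refine setIntegral_congr_fun measurableSet_Ioi (fun x _ => ?_)
  simp only [add_sub_cancel_right, Real.rpow_natCast]
  ring

lemma gammaTail_le_one (j : ℕ) {R : ℝ} (hR : 0 ≤ R) : gammaTail j R ≤ 1 := by
  rw [gammaTail, div_le_one (by positivity), ← integral_pow_mul_exp_neg]
  refine setIntegral_mono_set (integrableOn_pow_mul_exp_neg j) ?_
    (Set.Ioi_subset_Ioi hR).eventuallyLE
  filter_upwards [ae_restrict_mem measurableSet_Ioi] with x hx
  have : 0 < x := hx
  simp only [Pi.zero_apply]
  positivity

lemma pow_mul_exp_neg_div_factorial_le_gammaTail (j : ℕ) {R : ℝ} (hR : 0 ≤ R) :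
    R ^ j * exp (-R) / (j.factorial : ℝ) ≤ gammaTail j R := by
  rw [gammaTail]
  gcongr
  rw [← integral_exp_neg_Ioi, ← integral_const_mul]
  refine setIntegral_mono_on ((integrableOn_exp_neg_Ioi R).const_mul _)
    ((integrableOn_pow_mul_exp_neg j).mono_set (Set.Ioi_subset_Ioi hR)) measurableSet_Ioi
    (fun x hx => ?_)
  have : R < x := hx
  gcongr

/-- Chebyshev-type estimate, obtained from the second moment of `1 - (i + 1) / X`. -/
lemma one_sub_le_gammaTail (i : ℕ) {R : ℝ} (hR : 0 < R) (hi : R < i + 1) :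
    1 - R / (i + 1 - R) ^ 2 ≤ gammaTail (i + 2) R := by
  have hf := integrableOn_pow_mul_exp_neg (i + 2)
  have h1 := integrableOn_pow_mul_exp_neg (i + 1)
  have h0 := integrableOn_pow_mul_exp_neg i
  have hu : 0 < (i : ℝ) + 1 - R := by linarith
  have hsplit : ∫ x in Set.Ioi (0 : ℝ), x ^ (i + 2) * exp (-x) =
      (∫ x in Set.Ioc 0 R, x ^ (i + 2) * exp (-x)) +
        ∫ x in Set.Ioi R, x ^ (i + 2) * exp (-x) := by
    rw [← Set.Ioc_union_Ioi_eq_Ioi hR.le]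
    exact setIntegral_union (Set.Ioc_disjoint_Ioi le_rfl) measurableSet_Ioi
      (hf.mono_set Set.Ioc_subset_Ioi_self) (hf.mono_set (Set.Ioi_subset_Ioi hR.le))
  set g : ℝ → ℝ := fun x => (R / (i + 1 - R)) ^ 2 *
    (x ^ (i + 2) * exp (-x) - 2 * (i + 1) * (x ^ (i + 1) * exp (-x)) +
      (i + 1) ^ 2 * (x ^ i * exp (-x))) with hg
  have hgi : IntegrableOn g (Set.Ioi 0) :=
    ((hf.sub (h1.const_mul _)).add (h0.const_mul _)).const_mul _
  have hgeq : ∀ x, g x = (R / (i + 1 - R)) ^ 2 * (x ^ i * exp (-x) * (i + 1 - x) ^ 2) := by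
    intro x
    simp only [hg]
    ring
  have hgint : ∫ x in Set.Ioi (0 : ℝ), g x =
      (R / (i + 1 - R)) ^ 2 * ((i + 1).factorial : ℝ) := by
    simp only [hg]
    rw [integral_const_mul, integral_add, integral_sub, integral_const_mul, integral_const_mul,
      integral_pow_mul_exp_neg, integral_pow_mul_exp_neg, integral_pow_mul_exp_neg]
    · simp only [Nat.factorial_succ]
      push_cast
      ring
    · exact hf
    · exact h1.const_mul _
    · exact hf.sub (h1.const_mul _)
    · exact h0.const_mul _
  have hle : ∫ x in Set.Ioc 0 R, x ^ (i + 2) * exp (-x) ≤ ∫ x in Set.Ioi (0 : ℝ), g x := by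
    calc _ ≤ ∫ x in Set.Ioc 0 R, g x := by
          refine setIntegral_mono_on (hf.mono_set Set.Ioc_subset_Ioi_self)
            (hgi.mono_set Set.Ioc_subset_Ioi_self) measurableSet_Ioc (fun x hx => ?_)
          have hx0 : 0 < x := hx.1
          have hxR : x ≤ R := hx.2
          have hsq : x ≤ R / (i + 1 - R) * (i + 1 - x) := by
            rw [div_mul_eq_mul_div, le_div_iff₀ hu]
            nlinarith
          have hsq2 := pow_le_pow_left₀ hx0.le hsq 2
          rw [hgeq]
          calc x ^ (i + 2) * exp (-x) = x ^ i * exp (-x) * x ^ 2 := by ring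
            _ ≤ x ^ i * exp (-x) * (R / (i + 1 - R) * (i + 1 - x)) ^ 2 := by gcongr
            _ = _ := by ring
      _ ≤ _ := by
          refine setIntegral_mono_set hgi ?_ Set.Ioc_subset_Ioi_self.eventuallyLE
          filter_upwards [ae_restrict_mem measurableSet_Ioi] with x hx
          have : 0 < x := hx
          rw [hgeq]
          simp only [Pi.zero_apply]
          positivity
  rw [hgint] at hle
  rw [integral_pow_mul_exp_neg] at hsplit
  rw [gammaTail, le_div_iff₀ (by positivity)]
  have hfac : ((i + 2).factorial : ℝ) = (i + 2) * ((i + 1).factorial : ℝ) := by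
    rw [Nat.factorial_succ]
    push_cast
    ring
  have hkey : (R / (i + 1 - R)) ^ 2 * ((i + 1).factorial : ℝ) ≤
      R / (i + 1 - R) ^ 2 * ((i + 2).factorial : ℝ) := by
    have hF : (0 : ℝ) < ((i + 1).factorial : ℝ) := by positivity
    rw [hfac, div_pow, div_mul_eq_mul_div, div_mul_eq_mul_div]
    refine div_le_div_of_nonneg_right ?_ (by positivity)
    nlinarith [mul_nonneg (mul_pos hR hF).le (show (0 : ℝ) ≤ i + 2 - R by linarith)]
  linarith

lemma exp_neg_two_mul_le_one_sub {x : ℝ} (hx : 0 ≤ x) (hx' : x ≤ 1 / 2) : exp (-(2 * x)) ≤ 1 - x := by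
  rw [exp_neg, inv_le_comm₀ (exp_pos _) (by linarith)]
  have h := add_one_le_exp (2 * x)
  refine le_trans ?_ h
  rw [inv_le_iff_one_le_mul₀ (by linarith)]
  nlinarith

lemma exp_le_prod_gammaTail {w : ℝ} (hw : 1 ≤ w) {i₀ : ℕ} (hi₀ : w ^ 2 + 2 * w ≤ i₀) (K : ℕ) :
    exp (-(2 * w)) ≤ ∏ i ∈ Finset.range K, gammaTail (i₀ + i + 2) (w ^ 2) := by
  have hw0 : 0 < w := by linarith
  have key : ∀ K : ℕ, exp (2 * w ^ 2 / (i₀ + K - w ^ 2) - 2 * w ^ 2 / (i₀ - w ^ 2)) ≤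
      ∏ i ∈ Finset.range K, gammaTail (i₀ + i + 2) (w ^ 2) := by
    intro K
    induction K with
    | zero => simp
    | succ K ih =>
      rw [Finset.prod_range_succ]
      have hK : (0 : ℝ) ≤ K := by positivity
      set u : ℝ := i₀ + K - w ^ 2 with hu
      have hu2 : 2 * w ≤ u := by linarith
      have hu0 : 0 < u := by linarith
      have h1 := one_sub_le_gammaTail (i₀ + K) (R := w ^ 2) (by positivity)
        (by push_cast; linarith)
      have e1 : ((i₀ + K : ℕ) : ℝ) + 1 - w ^ 2 = u + 1 := by push_cast; ring
      rw [e1] at h1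
      have h2 : exp (-(2 * (w ^ 2 / (u + 1) ^ 2))) ≤ 1 - w ^ 2 / (u + 1) ^ 2 := by
        refine exp_neg_two_mul_le_one_sub (by positivity) ?_
        rw [div_le_div_iff₀ (by positivity) (by norm_num)]
        nlinarith
      have h3 : 2 * w ^ 2 / (u + 1) - 2 * w ^ 2 / u ≤ -(2 * (w ^ 2 / (u + 1) ^ 2)) := by
        have : -(2 * (w ^ 2 / (u + 1) ^ 2)) - (2 * w ^ 2 / (u + 1) - 2 * w ^ 2 / u) =
            2 * w ^ 2 / (u * (u + 1) ^ 2) := by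
          field_simp
          ring
        have h4 : 0 ≤ 2 * w ^ 2 / (u * (u + 1) ^ 2) := by positivity
        linarith
      have e2 : (i₀ : ℝ) + ((K + 1 : ℕ) : ℝ) - w ^ 2 = u + 1 := by push_cast; ring
      rw [e2]
      calc exp (2 * w ^ 2 / (u + 1) - 2 * w ^ 2 / (i₀ - w ^ 2)) =
            exp (2 * w ^ 2 / u - 2 * w ^ 2 / (i₀ - w ^ 2)) *
              exp (2 * w ^ 2 / (u + 1) - 2 * w ^ 2 / u) := by
            rw [← exp_add]
            ring_nf
        _ ≤ _ := by
            refine mul_le_mul ih ?_ (exp_pos _).le (le_trans (exp_pos _).le ih)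
            exact (exp_le_exp.2 h3).trans (h2.trans h1)
  refine le_trans (exp_le_exp.2 ?_) (key K)
  have h5 : 0 ≤ 2 * w ^ 2 / (i₀ + K - w ^ 2) := by
    have : (0 : ℝ) ≤ K := by positivity
    have : (0 : ℝ) ≤ i₀ + K - w ^ 2 := by linarith
    positivity
  have h6 : 2 * w ^ 2 / (i₀ - w ^ 2) ≤ 2 * w := by
    rw [div_le_iff₀ (by linarith)]
    nlinarith
  linarith

lemma abs_bernoulliPeriodic₂_le (x : ℝ) : |bernoulliPeriodic₂ x| ≤ 1 / 6 := by
  have h0 := Int.fract_nonneg x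
  have h1 := (Int.fract_lt_one x).le
  rw [bernoulliPeriodic₂, abs_le]
  constructor <;> nlinarith [sq_nonneg (Int.fract x - 1 / 2), mul_nonneg h0 (sub_nonneg.2 h1)]

lemma integrableOn_and_integral_inv_add_sq {m : ℝ} (hm : 0 ≤ m) :
    IntegrableOn (fun x : ℝ => 1 / (m + x) ^ 2) (Set.Ioi 1) ∧
      ∫ x in Set.Ioi (1 : ℝ), 1 / (m + x) ^ 2 = 1 / (m + 1) := by
  have hd : ∀ x ∈ Set.Ici (1 : ℝ),
      HasDerivAt (fun x : ℝ => -(1 / (m + x))) (1 / (m + x) ^ 2) x := by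
    intro x hx
    have hx1 : (1 : ℝ) ≤ x := hx
    have hne : m + x ≠ 0 := by linarith
    have h := (((hasDerivAt_id x).const_add m).inv hne).neg
    simp only [id] at h
    have hfun : (fun x : ℝ => -(1 / (m + x))) = -(fun x : ℝ => m + x)⁻¹ := by
      ext y
      simp
    rw [hfun]
    exact h.congr_deriv (by ring)
  have hpos : ∀ x ∈ Set.Ioi (1 : ℝ), 0 ≤ 1 / (m + x) ^ 2 := fun x _ => by positivity
  have hlim : Filter.Tendsto (fun x : ℝ => -(1 / (m + x))) Filter.atTop (nhds 0) := by
    have h : Filter.Tendsto (fun x : ℝ => m + x) Filter.atTop Filter.atTop :=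
      Filter.tendsto_atTop_add_const_left _ _ Filter.tendsto_id
    simpa using h.inv_tendsto_atTop.neg
  have hint := integrableOn_Ioi_deriv_of_nonneg' hd hpos hlim
  refine ⟨hint, ?_⟩
  rw [integral_Ioi_of_hasDerivAt_of_tendsto' hd hint hlim]
  ring

lemma neg_le_integral_bernoulliPeriodic₂ {m : ℝ} (hm : 0 ≤ m) :
    -(1 / (6 * (m + 1))) ≤ ∫ x in Set.Ioi (1 : ℝ), bernoulliPeriodic₂ x / (m + x) ^ 2 := by
  obtain ⟨hi, he⟩ := integrableOn_and_integral_inv_add_sq hm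
  have h := norm_integral_le_of_norm_le (f := fun x => bernoulliPeriodic₂ x / (m + x) ^ 2)
    (hi.const_mul (1 / 6)) (Filter.Eventually.of_forall fun x => by
      rw [Real.norm_eq_abs, abs_div, abs_of_nonneg (sq_nonneg (m + x)), div_eq_mul_one_div]
      exact mul_le_mul_of_nonneg_right (abs_bernoulliPeriodic₂_le x) (by positivity))
  rw [integral_const_mul, he, Real.norm_eq_abs] at h
  have h2 := (abs_le.1 h).1
  have : 1 / 6 * (1 / (m + 1)) = 1 / (6 * (m + 1)) := by
    rw [one_div_mul_one_div]
  linarith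

lemma le_holeConstC_add_log_Gamma (m : ℕ) :
    5 / 4 + 2 / 5 ≤ holeConstC m + log (Gamma ((m : ℝ) + 1)) + log 4 := by
  have hI := neg_le_integral_bernoulliPeriodic₂ (m := m) (by positivity)
  have hS := Stirling.le_log_factorial_stirling (n := m + 1) (by omega)
  have hm : (0 : ℝ) ≤ m := by positivity
  have hfac : log ((m + 1).factorial : ℝ) = log (m + 1) + log (m.factorial : ℝ) := by
    rw [Nat.factorial_succ]
    push_cast
    exact log_mul (by positivity) (by positivity)
  rw [hfac] at hS
  push_cast at hS
  have hpi : 1 ≤ log (2 * π) := by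
    rw [le_log_iff_exp_le (by positivity)]
    linarith [exp_one_lt_d9, pi_gt_three]
  have h4 : log 4 = 2 * log 2 := by
    rw [show (4 : ℝ) = 2 ^ 2 by norm_num, log_pow]
    push_cast
    ring
  have h2 := log_two_gt_d9
  have e1 : 1 / (12 * ((m : ℝ) + 1)) = 1 / 2 * (1 / (6 * ((m : ℝ) + 1))) := by
    field_simp
    norm_num
  have e2 : 1 / (6 * ((m : ℝ) + 1)) ≤ 1 / 6 := by
    rw [div_le_div_iff₀ (by positivity) (by norm_num)]
    linarith
  rw [Real.Gamma_nat_eq_factorial, holeConstC, h4, e1, add_comm (1 : ℝ) m]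
  linarith

lemma log_factorial_le (N : ℕ) (hN : N ≠ 0) :
    log (N.factorial : ℝ) ≤ 1 + (N + 1 / 2) * log N - N := by
  obtain ⟨k, rfl⟩ := Nat.exists_eq_succ_of_ne_zero hN
  have h := Stirling.stirlingSeq'_antitone (Nat.zero_le k)
  simp only [Function.comp] at h
  have h1 := log_le_log (Stirling.stirlingSeq'_pos k) h
  rw [Nat.succ_eq_add_one, zero_add, Stirling.stirlingSeq_one, Stirling.log_stirlingSeq_formula,
    log_div (exp_ne_zero _) (by positivity), log_exp, log_sqrt (by norm_num)] at h1
  have hk : (0 : ℝ) < ((k + 1 : ℕ) : ℝ) := by positivity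
  rw [log_mul (by norm_num) hk.ne', log_div hk.ne' (exp_ne_zero _), log_exp] at h1
  rw [Nat.succ_eq_add_one]
  linarith

lemma sum_log_factorial_le (N : ℕ) :
    ∑ j ∈ Finset.range N, log (j.factorial : ℝ) ≤
      (N : ℝ) ^ 2 / 2 * log N - 3 / 4 * (N : ℝ) ^ 2 + 5 / 4 * N := by
  induction N with
  | zero => simp
  | succ N ih =>
    rw [Finset.sum_range_succ]
    rcases Nat.eq_zero_or_pos N with rfl | hN
    · norm_num
    have hf := log_factorial_le N hN.ne'
    have hN' : (0 : ℝ) < N := by exact_mod_cast hN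
    have hl : 1 / ((N : ℝ) + 1) ≤ log (N + 1) - log N := by
      have h := one_sub_inv_le_log_of_pos (x := ((N : ℝ) + 1) / N) (by positivity)
      rw [log_div (by positivity) hN'.ne'] at h
      refine le_trans (le_of_eq ?_) h
      field_simp
      ring
    have hl2 : ((N : ℝ) + 1) / 2 ≤ ((N : ℝ) + 1) ^ 2 / 2 * (log (N + 1) - log N) := by
      refine le_trans (le_of_eq ?_) (mul_le_mul_of_nonneg_left hl (by positivity))
      field_simp
    push_cast
    linarith

lemma prod_gammaTail_le_setIntegral {n : ℕ} (hn : 1 ≤ n) (m : Fin n → ℕ) (k : ℕ) {R r : ℝ}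
    (hR : 0 < R) (hr : R ^ n = r ^ 2) :
    ∏ a, gammaTail (k + m a) R ≤
      ∫ x : Fin n → ℝ in {x | (∀ a, 0 < x a) ∧ r ^ 2 < ∏ a, x a},
        ∏ a, x a ^ (((k + 1 : ℕ) : ℝ) + (m a : ℝ) - 1) * Real.exp (-x a) /
          Real.Gamma (((k + 1 : ℕ) : ℝ) + (m a : ℝ)) := by
  set f : Fin n → ℝ → ℝ := fun a x => x ^ (k + m a) * exp (-x) / ((k + m a).factorial : ℝ)
    with hf
  have hfun : ∀ (a : Fin n) (x : ℝ), x ^ (((k + 1 : ℕ) : ℝ) + (m a : ℝ) - 1) * Real.exp (-x) /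
      Real.Gamma (((k + 1 : ℕ) : ℝ) + (m a : ℝ)) = f a x := by
    intro a x
    have e1 : ((k + 1 : ℕ) : ℝ) + (m a : ℝ) - 1 = ((k + m a : ℕ) : ℝ) := by
      push_cast
      ring
    have e2 : ((k + 1 : ℕ) : ℝ) + (m a : ℝ) = ((k + m a : ℕ) : ℝ) + 1 := by
      push_cast
      ring
    rw [e1, e2, Real.rpow_natCast, Real.Gamma_nat_eq_factorial]
  simp_rw [hfun]
  have hbox : ∏ a, gammaTail (k + m a) R =
      ∫ x : Fin n → ℝ in Set.univ.pi fun _ => Set.Ioi R, ∏ a, f a (x a) := by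
    rw [volume_pi, Measure.restrict_pi_pi, integral_fintype_prod_eq_prod]
    refine Finset.prod_congr rfl fun a _ => ?_
    rw [gammaTail, ← integral_div]
  have hint : IntegrableOn (fun x : Fin n → ℝ => ∏ a, f a (x a))
      (Set.univ.pi fun _ => Set.Ioi 0) := by
    rw [IntegrableOn, volume_pi, Measure.restrict_pi_pi]
    exact Integrable.fintype_prod fun a => (integrableOn_pow_mul_exp_neg (k + m a)).div_const _
  have hsub : {x : Fin n → ℝ | (∀ a, 0 < x a) ∧ r ^ 2 < ∏ a, x a} ⊆
      Set.univ.pi fun _ => Set.Ioi 0 := fun x hx a _ => hx.1 a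
  have hsub' : (Set.univ.pi fun _ => Set.Ioi R) ⊆
      {x : Fin n → ℝ | (∀ a, 0 < x a) ∧ r ^ 2 < ∏ a, x a} := by
    intro x hx
    have hx' : ∀ a, R < x a := fun a => hx a (Set.mem_univ a)
    refine ⟨fun a => hR.trans (hx' a), ?_⟩
    have : Nonempty (Fin n) := ⟨⟨0, hn⟩⟩
    have h := Finset.prod_lt_prod_of_nonempty (s := Finset.univ) (f := fun _ : Fin n => R)
      (g := x) (fun _ _ => hR) (fun a _ => hx' a) Finset.univ_nonempty
    simpa [hr] using h
  rw [hbox]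
  refine setIntegral_mono_set (hint.mono_set hsub) ?_ hsub'.eventuallyLE
  have hmeas : MeasurableSet {x : Fin n → ℝ | (∀ a, 0 < x a) ∧ r ^ 2 < ∏ a, x a} := by
    rw [Set.ofPred_and, Set.ofPred_forall]
    exact (MeasurableSet.iInter fun a =>
        measurableSet_lt measurable_const (measurable_pi_apply a)).inter
      (measurableSet_lt measurable_const
        (Finset.measurable_fun_prod _ fun a _ => measurable_pi_apply a))
  filter_upwards [ae_restrict_mem hmeas] with x hx
  refine Finset.prod_nonneg fun a _ => ?_
  have := hx.1 a
  simp only [hf]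
  positivity

lemma sum_range_cast (N : ℕ) : ∑ j ∈ Finset.range N, (j : ℝ) = N * (N - 1) / 2 := by
  induction N with
  | zero => simp
  | succ N ih =>
    rw [Finset.sum_range_succ, ih]
    push_cast
    ring

lemma log_one_add_le {t : ℝ} (ht : 0 ≤ t) (ht' : t ≤ 1 / 2) :
    log (1 + t) ≤ t - t ^ 2 / 2 + 2 * t ^ 3 := by
  have h := Real.abs_log_sub_add_sum_range_le (x := -t)
    (by rw [abs_neg, abs_of_nonneg ht]; linarith) 2
  rw [abs_neg, abs_of_nonneg ht, sub_neg_eq_add] at h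
  norm_num [Finset.sum_range_succ] at h
  have h1 := (abs_le.1 h).2
  have h2 : t ^ 3 / (1 - t) ≤ 2 * t ^ 3 := by
    rw [div_le_iff₀ (by linarith)]
    nlinarith [pow_nonneg ht 3]
  linarith

/-- The exponent collected from the indices below `N = w² + d`, with `2w ≤ d ≤ 3w`, and from the
remaining tail dominates the claimed one. -/
lemma hole_exponent_le {w d : ℝ} (hw : 400 ≤ w) (hlog : log w ≤ w / 30) (hd0 : 0 ≤ d)
    (hd : d ≤ 3 * w) :
    -(1 / 4) * (w ^ 2) ^ 2 - 1 / 2 * w ^ 2 * log (w ^ 2) - (5 / 4 + 2 / 5) * w ^ 2 ≤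
      -w ^ 2 * (w ^ 2 + d) + (w ^ 2 + d) * (w ^ 2 + d - 1) / 2 * log (w ^ 2) -
        ((w ^ 2 + d) ^ 2 / 2 * log (w ^ 2 + d) - 3 / 4 * (w ^ 2 + d) ^ 2 + 5 / 4 * (w ^ 2 + d)) -
        2 * w := by
  have hw0 : 0 < w := by linarith
  obtain ⟨t, rfl⟩ : ∃ t, d = w ^ 2 * t := ⟨d / w ^ 2, by field_simp⟩
  have ht0 : 0 ≤ t := nonneg_of_mul_nonneg_right hd0 (by positivity)
  have hwt : w * t ≤ 3 := by nlinarith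
  have ht1 : t ≤ 1 / 2 := by nlinarith
  have hl := log_one_add_le ht0 ht1
  have hN : log (w ^ 2 + w ^ 2 * t) = 2 * log w + log (1 + t) := by
    rw [show w ^ 2 + w ^ 2 * t = w ^ 2 * (1 + t) by ring, log_mul (by positivity) (by positivity),
      log_pow]
    push_cast
    ring
  have hR : log (w ^ 2) = 2 * log w := by
    rw [log_pow]
    push_cast
    ring
  rw [hN, hR]
  have hl2 : (w ^ 2 + w ^ 2 * t) ^ 2 / 2 * log (1 + t) ≤
      (w ^ 2 + w ^ 2 * t) ^ 2 / 2 * (t - t ^ 2 / 2 + 2 * t ^ 3) :=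
    mul_le_mul_of_nonneg_left hl (by positivity)
  have h3 : w ^ 4 * t ^ 3 ≤ 27 * w := by
    have : (w * t) ^ 3 ≤ 3 ^ 3 := pow_le_pow_left₀ (by positivity) hwt 3
    nlinarith
  have h4 : w ^ 4 * t ^ 3 * (1 + 7 / 4 * t + t ^ 2) ≤ 27 * w * 4 := by
    refine mul_le_mul h3 ?_ (by positivity) (by positivity)
    nlinarith
  have h5 : w ^ 2 * t * log w ≤ 3 * w * (w / 30) :=
    mul_le_mul hd hlog (log_nonneg (by linarith)) (by positivity)
  nlinarith

lemma exp_le_prod_gammaTail_add (m : ℕ) {w : ℝ} (hw : 400 ≤ w) (hlog : log w ≤ w / 30)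
    (hm : (m : ℝ) ≤ w) :
    ∃ K₀ : ℕ, ∀ K ≥ K₀,
      exp (-(1 / 4) * (w ^ 2) ^ 2 - 1 / 2 * w ^ 2 * log (w ^ 2) - (5 / 4 + 2 / 5 - m) * w ^ 2 -
          (m : ℝ) ^ 2 * log (w ^ 2)) ≤
        ∏ k ∈ Finset.range K, gammaTail (k + m) (w ^ 2) := by
  have hw0 : 0 < w := by linarith
  have hlR : 0 ≤ log (w ^ 2) := log_nonneg (by nlinarith)
  set i₀ : ℕ := ⌈w ^ 2 + 2 * w⌉₊ with hi₀
  have hi1 : w ^ 2 + 2 * w ≤ i₀ := Nat.le_ceil _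
  have hi2 : (i₀ : ℝ) < w ^ 2 + 2 * w + 1 := Nat.ceil_lt_add_one (by positivity)
  have hmN : m ≤ i₀ + 2 := by
    have : (m : ℝ) ≤ ((i₀ + 2 : ℕ) : ℝ) := by
      push_cast
      nlinarith
    exact_mod_cast this
  obtain ⟨L, hL⟩ := Nat.exists_eq_add_of_le hmN
  refine ⟨L, fun K hK => ?_⟩
  obtain ⟨K', rfl⟩ := Nat.exists_eq_add_of_le hK
  have hhead : exp (∑ k ∈ Finset.range L,
      (-w ^ 2 + ((m + k : ℕ) : ℝ) * log (w ^ 2) - log ((m + k).factorial : ℝ))) ≤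
      ∏ k ∈ Finset.range L, gammaTail (k + m) (w ^ 2) := by
    rw [exp_sum]
    refine Finset.prod_le_prod (fun _ _ => (exp_pos _).le) fun k _ => ?_
    refine le_trans (le_of_eq ?_)
      (pow_mul_exp_neg_div_factorial_le_gammaTail (k + m) (sq_nonneg w))
    rw [add_comm k m, exp_sub, exp_log (by positivity), exp_add, mul_comm ((m + k : ℕ) : ℝ),
      exp_mul, exp_log (by positivity), Real.rpow_natCast, mul_comm (exp _)]
  have htail := exp_le_prod_gammaTail (by linarith) hi1 K'
  have hsplit := Finset.sum_range_add
    (fun j : ℕ => -w ^ 2 + (j : ℝ) * log (w ^ 2) - log (j.factorial : ℝ)) m L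
  have hsum : ∀ N : ℕ, ∑ j ∈ Finset.range N,
      (-w ^ 2 + (j : ℝ) * log (w ^ 2) - log (j.factorial : ℝ)) =
      -w ^ 2 * N + N * (N - 1) / 2 * log (w ^ 2) -
        ∑ j ∈ Finset.range N, log (j.factorial : ℝ) := by
    intro N
    rw [Finset.sum_sub_distrib, Finset.sum_add_distrib, ← Finset.sum_mul, sum_range_cast]
    simp [mul_comm]
  rw [← hL, hsum, hsum] at hsplit
  have hB := sum_log_factorial_le (i₀ + 2)
  have hm0 : 0 ≤ ∑ j ∈ Finset.range m, log (j.factorial : ℝ) :=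
    Finset.sum_nonneg fun j _ => log_nonneg (by exact_mod_cast j.factorial_pos)
  have hm2 : (m : ℝ) * (m - 1) / 2 * log (w ^ 2) ≤ (m : ℝ) ^ 2 * log (w ^ 2) := by
    refine mul_le_mul_of_nonneg_right ?_ hlR
    have : (0 : ℝ) ≤ m := by positivity
    nlinarith
  have hfin := hole_exponent_le (d := ((i₀ + 2 : ℕ) : ℝ) - w ^ 2) hw hlog
    (by push_cast; linarith) (by push_cast; linarith)
  rw [add_sub_cancel] at hfin
  rw [Finset.prod_range_add]
  have hidx : ∏ x ∈ Finset.range K', gammaTail (L + x + m) (w ^ 2) =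
      ∏ i ∈ Finset.range K', gammaTail (i₀ + i + 2) (w ^ 2) := by
    refine Finset.prod_congr rfl fun i _ => ?_
    congr 1
    omega
  rw [hidx]
  refine le_trans ?_ (mul_le_mul hhead htail (exp_pos _).le ((exp_pos _).le.trans hhead))
  rw [← exp_add, exp_le_exp]
  linarith

lemma gammaTail_nonneg (j : ℕ) {R : ℝ} (hR : 0 ≤ R) : 0 ≤ gammaTail j R :=
  le_trans (by positivity) (pow_mul_exp_neg_div_factorial_le_gammaTail j hR)

/-- Lower bound for the hole probability of the generalised induced infinite complex
Ginibre ensemble with nonnegative integer parameters `m_1, …, m_n`. -/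
theorem hole_probability_infinite_lower_bound
    (n : ℕ) (hn : 1 ≤ n) (m : Fin n → ℕ)
    (p : ℕ → ℝ → ℝ)
    (hp : ∀ (k : ℕ) (r : ℝ), p k r =
      ∫ x : Fin n → ℝ in {x | (∀ a, 0 < x a) ∧ r ^ 2 < ∏ a, x a},
        ∏ a, x a ^ ((k : ℝ) + (m a : ℝ) - 1) * Real.exp (-x a) /
          Real.Gamma ((k : ℝ) + (m a : ℝ))) :
    ∃ C > 0, ∃ R₀ > 1, ∀ r ≥ R₀,
      Real.exp (-((n : ℝ) / 4) * r ^ ((4 : ℝ) / n)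
          - ((n : ℝ) / 2) * r ^ ((2 : ℝ) / n) * Real.log (r ^ ((2 : ℝ) / n))
          - (∑ a, (holeConstC (m a) - (m a : ℝ)
              + Real.log (Real.Gamma ((m a : ℝ) + 1)) + Real.log 4)) * r ^ ((2 : ℝ) / n)
          - C * Real.log r)
        ≤ ∏' k : ℕ, p (k + 1) r := by
  have hn0 : (0 : ℝ) < n := by exact_mod_cast hn
  refine ⟨∑ a, 2 / (n : ℝ) * (m a : ℝ) ^ 2 + 1, by positivity, ?_⟩
  have hroot : Filter.Tendsto (fun r : ℝ => r ^ (1 / (n : ℝ))) Filter.atTop Filter.atTop :=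
    tendsto_rpow_atTop (by positivity)
  have hlogev : ∀ᶠ w : ℝ in Filter.atTop, log w ≤ w / 30 := by
    filter_upwards [isLittleO_log_id_atTop.bound (show (0 : ℝ) < 1 / 30 by norm_num),
      Filter.eventually_ge_atTop 0] with w h h0
    rw [id, norm_eq_abs, norm_eq_abs, abs_of_nonneg h0] at h
    linarith [le_abs_self (log w)]
  have hev : ∀ᶠ w : ℝ in Filter.atTop,
      400 ≤ w ∧ log w ≤ w / 30 ∧ ∀ a, (m a : ℝ) ≤ w := by
    filter_upwards [Filter.eventually_ge_atTop 400, hlogev,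
      Filter.eventually_all.2 fun a => Filter.eventually_ge_atTop (m a : ℝ)] with w h1 h2 h3
    exact ⟨h1, h2, h3⟩
  obtain ⟨R₀, hR₀⟩ := Filter.eventually_atTop.1 (hroot.eventually hev)
  refine ⟨max R₀ 2, lt_max_of_lt_right (by norm_num), fun r hr => ?_⟩
  have hr2 : 2 ≤ r := (le_max_right _ _).trans hr
  have hr0 : 0 < r := by linarith
  obtain ⟨hw, hlog, hm⟩ := hR₀ r ((le_max_left _ _).trans hr)
  set w : ℝ := r ^ (1 / (n : ℝ)) with hwdef
  have hw0 : 0 < w := by linarith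
  have e2 : r ^ ((2 : ℝ) / n) = w ^ 2 := by
    rw [hwdef, ← Real.rpow_natCast, ← Real.rpow_mul hr0.le]
    congr 1
    push_cast
    ring
  have e4 : r ^ ((4 : ℝ) / n) = (w ^ 2) ^ 2 := by
    rw [← e2, ← Real.rpow_natCast, ← Real.rpow_mul hr0.le]
    congr 1
    push_cast
    ring
  have en : (w ^ 2) ^ n = r ^ 2 := by
    rw [← pow_mul, mul_comm, pow_mul, hwdef, ← Real.rpow_natCast (r ^ (1 / (n : ℝ))) n,
      ← Real.rpow_mul hr0.le, one_div_mul_cancel hn0.ne', Real.rpow_one]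
  have elog : log (w ^ 2) = 2 / (n : ℝ) * log r := by
    rw [← e2, Real.log_rpow hr0]
  have hlr : 0 ≤ log r := log_nonneg (by linarith)
  choose K₀ hK₀ using fun a => exp_le_prod_gammaTail_add (m a) hw hlog (hm a)
  have hpart : ∀ K, (∀ a, K₀ a ≤ K) →
      Real.exp (-((n : ℝ) / 4) * r ^ ((4 : ℝ) / n)
          - ((n : ℝ) / 2) * r ^ ((2 : ℝ) / n) * Real.log (r ^ ((2 : ℝ) / n))
          - (∑ a, (holeConstC (m a) - (m a : ℝ)
              + Real.log (Real.Gamma ((m a : ℝ) + 1)) + Real.log 4)) * r ^ ((2 : ℝ) / n)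
          - (∑ a, 2 / (n : ℝ) * (m a : ℝ) ^ 2 + 1) * Real.log r) ≤
        ∏ a, ∏ k ∈ Finset.range K, gammaTail (k + m a) (w ^ 2) := by
    intro K hK
    refine le_trans ?_ (Finset.prod_le_prod (fun a _ => (exp_pos _).le)
      fun a _ => hK₀ a K (hK a))
    rw [← exp_sum, exp_le_exp, e2, e4]
    have hsum : ∑ a : Fin n, (-(1 / 4) * (w ^ 2) ^ 2 - 1 / 2 * w ^ 2 * log (w ^ 2) -
        (holeConstC (m a) - (m a : ℝ) + log (Gamma ((m a : ℝ) + 1)) + log 4) * w ^ 2 -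
        2 / (n : ℝ) * (m a : ℝ) ^ 2 * log r) ≤
        ∑ a : Fin n, (-(1 / 4) * (w ^ 2) ^ 2 - 1 / 2 * w ^ 2 * log (w ^ 2) -
          (5 / 4 + 2 / 5 - (m a : ℝ)) * w ^ 2 - (m a : ℝ) ^ 2 * log (w ^ 2)) := by
      refine Finset.sum_le_sum fun a _ => ?_
      have hc := mul_le_mul_of_nonneg_right (le_holeConstC_add_log_Gamma (m a)) (sq_nonneg w)
      have : (m a : ℝ) ^ 2 * log (w ^ 2) = 2 / (n : ℝ) * (m a : ℝ) ^ 2 * log r := by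
        rw [elog]
        ring
      linarith
    refine le_trans ?_ hsum
    rw [Finset.sum_sub_distrib, Finset.sum_sub_distrib, ← Finset.sum_mul, ← Finset.sum_mul,
      Finset.sum_const, Finset.card_univ, Fintype.card_fin, nsmul_eq_mul]
    linarith
  set K₁ : ℕ := Finset.univ.sup K₀ with hK₁
  have hK₁' : ∀ a, K₀ a ≤ K₁ := fun a => Finset.le_sup (Finset.mem_univ a)
  by_cases hmul : Multipliable fun k : ℕ => p (k + 1) r
  · refine ge_of_tendsto hmul.hasProd.tendsto_prod_nat ?_
    filter_upwards [Filter.eventually_ge_atTop K₁] with K hK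
    refine (hpart K fun a => (hK₁' a).trans hK).trans ?_
    rw [Finset.prod_comm]
    refine Finset.prod_le_prod
      (fun k _ => Finset.prod_nonneg fun a _ => gammaTail_nonneg _ (sq_nonneg w)) fun k _ => ?_
    rw [hp]
    exact prod_gammaTail_le_setIntegral hn m k (by positivity) en
  · rw [tprod_eq_one_of_not_multipliable hmul]
    refine (hpart K₁ hK₁').trans (Finset.prod_le_one
      (fun a _ => Finset.prod_nonneg fun k _ => gammaTail_nonneg _ (sq_nonneg w)) fun a _ =>
      Finset.prod_le_one (fun k _ => gammaTail_nonneg _ (sq_nonneg w))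
        fun k _ => gammaTail_le_one _ (sq_nonneg w))
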